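/- Let μ be a Borel probability measure on ℝ, I an open interval with μ(I) = 0, and suppose the Cauchy transform G_μ has a zero x₀ ∈ I. Then ρ({x₀}) = -1/((x₀² + 1) G_μ'(x₀)) and ρ(I \ {x₀}) = 0, where ρ is the measure in the Nevanlinna representation of F_μ = 1/G_μ. -/

import Mathlib

open MeasureTheory Set Complex

open Filter Topology

namespace CauchyNevanlinna

lemma ofReal_sub_ne_zero {z : ℂ} (hz : 0 < z.im) (s : ℝ) : (s : ℂ) - z ≠ 0 := by
  intro h
  have := congrArg Complex.im h
  simp at this
  exact hz.ne' this

lemma im_nevanlinna_kernel {x y : ℝ} (hy : 0 < y) (s : ℝ) :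
    ((1 + (s : ℂ) * (x + y * I)) / ((s : ℂ) - (x + y * I))).im
      = y * ((1 + s ^ 2) / ((s - x) ^ 2 + y ^ 2)) := by
  have h : (s - x) ^ 2 + y ^ 2 ≠ 0 := by positivity
  have h' : normSq ((s : ℂ) - (x + y * I)) = (s - x) ^ 2 + y ^ 2 := by
    simp [normSq_apply]; ring
  rw [Complex.div_im, h']
  simp
  field_simp
  ring

lemma integrable_nevanlinna_kernel (ρ : Measure ℝ) [IsFiniteMeasure ρ] {z : ℂ} (hz : 0 < z.im) :
    Integrable (fun s : ℝ => (1 + (s : ℂ) * z) / ((s : ℂ) - z)) ρ := by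
  have hcont : Continuous fun s : ℝ => (1 + (s : ℂ) * z) / ((s : ℂ) - z) :=
    Continuous.div (by fun_prop) (by fun_prop) (ofReal_sub_ne_zero hz)
  refine Integrable.of_bound hcont.aestronglyMeasurable (‖z‖ + ‖1 + z ^ 2‖ / z.im)
    (Eventually.of_forall fun s => ?_)
  have h0 := ofReal_sub_ne_zero hz s
  have h1 : (1 + (s : ℂ) * z) / ((s : ℂ) - z) = z + (1 + z ^ 2) / ((s : ℂ) - z) := by
    field_simp
    ring
  have h2 : z.im ≤ ‖(s : ℂ) - z‖ := by
    have := Complex.abs_im_le_norm ((s : ℂ) - z)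
    simp at this
    exact (le_abs_self _).trans this
  rw [h1]
  refine (norm_add_le _ _).trans ?_
  rw [norm_div]
  gcongr

lemma integrable_poisson_weight (ρ : Measure ℝ) [IsFiniteMeasure ρ] (x : ℝ) {y : ℝ} (hy : 0 < y) :
    Integrable (fun s : ℝ => (1 + s ^ 2) / ((s - x) ^ 2 + y ^ 2)) ρ := by
  have h := (integrable_nevanlinna_kernel ρ (z := x + y * I) (by simpa using hy)).im
  refine (h.const_mul y⁻¹).congr (Eventually.of_forall fun s => ?_)
  have := im_nevanlinna_kernel (x := x) hy s
  simp only [RCLike.im_eq_complex_im]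
  rw [this]
  field_simp

lemma im_integral_nevanlinna_kernel (ρ : Measure ℝ) [IsFiniteMeasure ρ] (x : ℝ) {y : ℝ}
    (hy : 0 < y) :
    (∫ s : ℝ, (1 + (s : ℂ) * (x + y * I)) / ((s : ℂ) - (x + y * I)) ∂ρ).im
      = y * ∫ s : ℝ, (1 + s ^ 2) / ((s - x) ^ 2 + y ^ 2) ∂ρ := by
  have h := integral_im (integrable_nevanlinna_kernel ρ (z := x + y * I) (by simpa using hy))
  simp only [RCLike.im_eq_complex_im] at h
  rw [← h, ← integral_const_mul]
  exact integral_congr_ae (Eventually.of_forall fun s => im_nevanlinna_kernel hy s)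

lemma integrable_cauchy_kernel (μ : Measure ℝ) [IsFiniteMeasure μ] {z : ℂ} (hz : 0 < z.im) :
    Integrable (fun s : ℝ => (z - (s : ℂ))⁻¹) μ := by
  have hne : ∀ s : ℝ, z - (s : ℂ) ≠ 0 := fun s h =>
    ofReal_sub_ne_zero hz s (by rw [← neg_sub, h, neg_zero])
  have hcont : Continuous fun s : ℝ => (z - (s : ℂ))⁻¹ := Continuous.inv₀ (by fun_prop) hne
  refine Integrable.of_bound hcont.aestronglyMeasurable (z.im)⁻¹ (Eventually.of_forall fun s => ?_)
  have h2 : z.im ≤ ‖z - (s : ℂ)‖ := by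
    have := Complex.abs_im_le_norm (z - (s : ℂ))
    simp at this
    exact (le_abs_self _).trans this
  rw [norm_inv]
  gcongr

lemma im_integral_cauchy_kernel (μ : Measure ℝ) [IsFiniteMeasure μ] (x : ℝ) {y : ℝ}
    (hy : 0 < y) :
    (∫ s : ℝ, ((x + y * I : ℂ) - (s : ℂ))⁻¹ ∂μ).im
      = -y * ∫ s : ℝ, ((x - s) ^ 2 + y ^ 2)⁻¹ ∂μ := by
  have h := integral_im (integrable_cauchy_kernel μ (z := x + y * I) (by simpa using hy))
  simp only [RCLike.im_eq_complex_im] at h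
  rw [← h, ← integral_const_mul]
  refine integral_congr_ae (Eventually.of_forall fun s => ?_)
  have h' : normSq ((x + y * I : ℂ) - s) = (x - s) ^ 2 + y ^ 2 := by
    simp [normSq_apply]; ring
  simp only [Complex.inv_im, h']
  simp
  ring

/-- Comparison of the imaginary parts in the Nevanlinna representation. -/
lemma one_add_mul_normSq {μ ρ : Measure ℝ} [IsFiniteMeasure μ] [IsFiniteMeasure ρ] {a : ℝ}
    (hNev : ∀ z : ℂ, 0 < z.im →
      (∫ s : ℝ, (z - (s : ℂ))⁻¹ ∂μ)⁻¹
        = (a : ℂ) + z + ∫ s : ℝ, (1 + (s : ℂ) * z) / ((s : ℂ) - z) ∂ρ)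
    (x : ℝ) {y : ℝ} (hy : 0 < y) :
    (1 + ∫ s : ℝ, (1 + s ^ 2) / ((s - x) ^ 2 + y ^ 2) ∂ρ)
        * normSq (∫ s : ℝ, ((x + y * I : ℂ) - (s : ℂ))⁻¹ ∂μ)
      = ∫ s : ℝ, ((x - s) ^ 2 + y ^ 2)⁻¹ ∂μ := by
  have h := congrArg Complex.im (hNev (x + y * I) (by simpa using hy))
  rw [Complex.inv_im, im_integral_cauchy_kernel μ x hy] at h
  simp only [Complex.add_im, im_integral_nevanlinna_kernel ρ x hy] at h
  simp at h
  have hR : 0 ≤ ∫ s : ℝ, (1 + s ^ 2) / ((s - x) ^ 2 + y ^ 2) ∂ρ :=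
    integral_nonneg fun s => by positivity
  set G := normSq (∫ s : ℝ, ((x + y * I : ℂ) - (s : ℂ))⁻¹ ∂μ)
  have hG : G ≠ 0 := by
    intro h0
    rw [h0] at h
    simp at h
    nlinarith [mul_nonneg hy.le hR]
  rw [← mul_right_inj' hy.ne', ← mul_assoc, mul_add, mul_one, ← h]
  field_simp

/-- A neighbourhood of a point of a `μ`-null open interval misses `μ`-almost every point. -/
lemma exists_pos_ae_le_abs_sub {μ : Measure ℝ} {c d x : ℝ} (hx : x ∈ Ioo c d)
    (hμI : μ (Ioo c d) = 0) : ∃ δ > 0, ∀ᵐ s ∂μ, δ ≤ |x - s| := by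
  refine ⟨min (x - c) (d - x), lt_min (by linarith [hx.1]) (by linarith [hx.2]), ?_⟩
  have : ∀ᵐ s ∂μ, s ∉ Ioo c d := measure_eq_zero_iff_ae_notMem.mp hμI
  filter_upwards [this] with s hs
  by_contra! hlt
  rw [lt_min_iff, abs_lt, abs_lt] at hlt
  exact hs ⟨by linarith, by linarith⟩

lemma abs_sub_le_norm (x y s : ℝ) : |x - s| ≤ ‖(x + y * I : ℂ) - s‖ := by
  simpa using Complex.abs_re_le_norm ((x + y * I : ℂ) - s)

/-- The limit at `x` of the divided difference of the Cauchy transform at `x₀`. -/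
lemma tendsto_dividedDifference {μ : Measure ℝ} [IsFiniteMeasure μ] {c d x x₀ : ℝ}
    (hx : x ∈ Ioo c d) (hx₀ : x₀ ∈ Ioo c d) (hμI : μ (Ioo c d) = 0) :
    Tendsto (fun y : ℝ => ∫ s : ℝ, (((x + y * I : ℂ) - s) * (x₀ - s))⁻¹ ∂μ) (𝓝[>] 0)
      (𝓝 ((∫ s : ℝ, ((x - s) * (x₀ - s))⁻¹ ∂μ : ℝ) : ℂ)) := by
  obtain ⟨δ, hδ, hsδ⟩ := exists_pos_ae_le_abs_sub hx hμI
  obtain ⟨ε, hε, hsε⟩ := exists_pos_ae_le_abs_sub hx₀ hμI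
  rw [← integral_complex_ofReal]
  refine tendsto_integral_filter_of_dominated_convergence (fun _ => (δ * ε)⁻¹)
    (Eventually.of_forall fun y => ?_) (Eventually.of_forall fun y => ?_) (integrable_const _) ?_
  · exact Measurable.aestronglyMeasurable (by fun_prop)
  · filter_upwards [hsδ, hsε] with s h1 h2
    rw [norm_inv, norm_mul]
    have h3 : ε ≤ ‖(x₀ : ℂ) - s‖ := by
      rw [← ofReal_sub, norm_real]; exact h2
    have h4 := h1.trans (abs_sub_le_norm x y s)
    gcongr
  · filter_upwards [hsδ, hsε] with s h1 h2
    have h1' : (x : ℂ) - s ≠ 0 := by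
      rw [← ofReal_sub, ofReal_ne_zero]; exact abs_pos.mp (hδ.trans_le h1)
    have h2' : (x₀ : ℂ) - s ≠ 0 := by
      rw [← ofReal_sub, ofReal_ne_zero]; exact abs_pos.mp (hε.trans_le h2)
    have hc : ContinuousAt (fun y : ℝ => (((x + y * I : ℂ) - s) * (x₀ - s))⁻¹) 0 := by
      refine ContinuousAt.inv₀ (by fun_prop) ?_
      simpa using And.intro h1' h2'
    have := hc.tendsto.mono_left (nhdsWithin_le_nhds (s := Ioi 0))
    simpa using this

lemma cauchyTransform_eq_mul_dividedDifference {μ : Measure ℝ} [IsFiniteMeasure μ] {c d x₀ : ℝ}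
    (hx₀ : x₀ ∈ Ioo c d) (hμI : μ (Ioo c d) = 0) (hzero : (∫ s : ℝ, (x₀ - s)⁻¹ ∂μ) = 0)
    {z : ℂ} (hz : 0 < z.im) :
    ∫ s : ℝ, (z - (s : ℂ))⁻¹ ∂μ = -(z - x₀) * ∫ s : ℝ, ((z - s) * (x₀ - s))⁻¹ ∂μ := by
  obtain ⟨ε, hε, hsε⟩ := exists_pos_ae_le_abs_sub hx₀ hμI
  have hint : Integrable (fun s : ℝ => ((x₀ : ℂ) - s)⁻¹) μ := by
    refine Integrable.of_bound (Measurable.aestronglyMeasurable (by fun_prop)) ε⁻¹ ?_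
    filter_upwards [hsε] with s h2
    have h3 : ε ≤ ‖(x₀ : ℂ) - s‖ := by
      rw [← ofReal_sub, norm_real]; exact h2
    rw [norm_inv]
    gcongr
  have h0 : ∫ s : ℝ, ((x₀ : ℂ) - s)⁻¹ ∂μ = 0 := by
    have : ∫ s : ℝ, (((x₀ - s)⁻¹ : ℝ) : ℂ) ∂μ = 0 := by
      rw [integral_complex_ofReal, hzero, ofReal_zero]
    simpa using this
  rw [← sub_zero (∫ s : ℝ, (z - (s : ℂ))⁻¹ ∂μ), ← h0,
    ← integral_sub (integrable_cauchy_kernel μ hz) hint, ← integral_const_mul]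
  refine integral_congr_ae ?_
  filter_upwards [hsε] with s h2
  have h2' : (x₀ : ℂ) - s ≠ 0 := by
    rw [← ofReal_sub, ofReal_ne_zero]; exact abs_pos.mp (hε.trans_le h2)
  have h1' : z - (s : ℂ) ≠ 0 := fun h =>
    ofReal_sub_ne_zero hz s (by rw [← neg_sub, h, neg_zero])
  field_simp
  ring

lemma integral_inv_mul_pos {μ : Measure ℝ} [IsProbabilityMeasure μ] {c d x x₀ : ℝ}
    (hx : x ∈ Ioo c d) (hx₀ : x₀ ∈ Ioo c d) (hμI : μ (Ioo c d) = 0) :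
    0 < ∫ s : ℝ, ((x - s) * (x₀ - s))⁻¹ ∂μ := by
  obtain ⟨δ, hδ, hsδ⟩ := exists_pos_ae_le_abs_sub hx hμI
  obtain ⟨ε, hε, hsε⟩ := exists_pos_ae_le_abs_sub hx₀ hμI
  have hpos : ∀ᵐ s ∂μ, 0 < ((x - s) * (x₀ - s))⁻¹ := by
    have : ∀ᵐ s ∂μ, s ∉ Ioo c d := measure_eq_zero_iff_ae_notMem.mp hμI
    filter_upwards [this] with s hs
    refine inv_pos.mpr ?_
    rcases le_or_gt s c with h | h
    · exact mul_pos (by linarith [hx.1]) (by linarith [hx₀.1])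
    · have : d ≤ s := by by_contra! h'; exact hs ⟨h, h'⟩
      exact mul_pos_of_neg_of_neg (by linarith [hx.2]) (by linarith [hx₀.2])
  have hint : Integrable (fun s : ℝ => ((x - s) * (x₀ - s))⁻¹) μ := by
    refine Integrable.of_bound (Measurable.aestronglyMeasurable (by fun_prop)) (δ * ε)⁻¹ ?_
    filter_upwards [hsδ, hsε] with s h1 h2
    rw [norm_inv, norm_mul]
    simp only [Real.norm_eq_abs]
    gcongr
  refine (integral_pos_iff_support_of_nonneg_ae (hpos.mono fun s h => h.le) hint).mpr ?_
  refine pos_iff_ne_zero.mpr fun h0 => ?_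
  obtain ⟨s, hs, hs'⟩ := (hpos.and (measure_eq_zero_iff_ae_notMem.mp h0)).exists
  exact hs' hs.ne'

lemma tendsto_integral_inv_sq_add {μ : Measure ℝ} [IsFiniteMeasure μ] {c d x : ℝ}
    (hx : x ∈ Ioo c d) (hμI : μ (Ioo c d) = 0) :
    Tendsto (fun y : ℝ => ∫ s : ℝ, ((x - s) ^ 2 + y ^ 2)⁻¹ ∂μ) (𝓝[>] 0)
      (𝓝 (∫ s : ℝ, ((x - s) ^ 2)⁻¹ ∂μ)) := by
  obtain ⟨δ, hδ, hsδ⟩ := exists_pos_ae_le_abs_sub hx hμI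
  refine tendsto_integral_filter_of_dominated_convergence (fun _ => (δ ^ 2)⁻¹)
    (Eventually.of_forall fun y => ?_) (Eventually.of_forall fun y => ?_) (integrable_const _) ?_
  · exact Measurable.aestronglyMeasurable (by fun_prop)
  · filter_upwards [hsδ] with s h1
    have h3 : δ ^ 2 ≤ (x - s) ^ 2 + y ^ 2 := by
      rw [← sq_abs (x - s)]
      nlinarith [sq_nonneg y]
    rw [norm_inv, Real.norm_of_nonneg (by positivity)]
    gcongr
  · filter_upwards [hsδ] with s h1
    have h1' : x - s ≠ 0 := abs_pos.mp (hδ.trans_le h1)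
    have hc : ContinuousAt (fun y : ℝ => ((x - s) ^ 2 + y ^ 2)⁻¹) 0 := by
      refine ContinuousAt.inv₀ (by fun_prop) ?_
      simpa using h1'
    have := hc.tendsto.mono_left (nhdsWithin_le_nhds (s := Ioi 0))
    simpa using this

/-- The atom of `ρ` at `x` is recovered from its Poisson-type integrals. -/
lemma tendsto_sq_mul_integral (ρ : Measure ℝ) [IsFiniteMeasure ρ] (x : ℝ) :
    Tendsto (fun y : ℝ => y ^ 2 * ∫ s : ℝ, (1 + s ^ 2) / ((s - x) ^ 2 + y ^ 2) ∂ρ) (𝓝[>] 0)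
      (𝓝 ((1 + x ^ 2) * ρ.real {x})) := by
  have hlim : ∫ s : ℝ, ({x} : Set ℝ).indicator (fun _ => 1 + x ^ 2) s ∂ρ
      = (1 + x ^ 2) * ρ.real {x} := by
    rw [integral_indicator_const _ (measurableSet_singleton x), smul_eq_mul, mul_comm]
  rw [← hlim]
  simp only [← integral_const_mul]
  refine tendsto_integral_filter_of_dominated_convergence (fun _ => 3 + 2 * x ^ 2)
    (Eventually.of_forall fun y => ?_) ?_ (integrable_const _) (Eventually.of_forall fun s => ?_)
  · exact Measurable.aestronglyMeasurable (by fun_prop)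
  · filter_upwards [Ioc_mem_nhdsGT (zero_lt_one' ℝ)] with y hy
    refine Eventually.of_forall fun s => ?_
    have hy0 := hy.1
    have hy1 : y ^ 2 ≤ 1 := by nlinarith [hy.1, hy.2]
    rw [Real.norm_of_nonneg (by positivity), ← mul_div_assoc, div_le_iff₀ (by positivity)]
    have h1 : 1 + s ^ 2 ≤ 1 + 2 * (s - x) ^ 2 + 2 * x ^ 2 := by nlinarith [sq_nonneg (s - 2 * x)]
    have h2 : y ^ 2 * (s - x) ^ 2 ≤ (s - x) ^ 2 := mul_le_of_le_one_left (sq_nonneg _) hy1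
    nlinarith [mul_le_mul_of_nonneg_left h1 (sq_nonneg y), sq_nonneg (x * (s - x)),
      sq_nonneg (s - x), sq_nonneg y]
  · by_cases hs : s = x
    · subst hs
      simp only [mem_singleton_iff, indicator_of_mem, sub_self]
      refine tendsto_const_nhds.congr' ?_
      filter_upwards [self_mem_nhdsWithin] with y hy
      have : y ≠ 0 := (mem_Ioi.mp hy).ne'
      field_simp
      ring
    · have hs' : s - x ≠ 0 := sub_ne_zero.mpr hs
      rw [indicator_of_notMem (by simpa using hs)]
      have hc : ContinuousAt (fun y : ℝ => y ^ 2 * ((1 + s ^ 2) / ((s - x) ^ 2 + y ^ 2))) 0 := by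
        refine ContinuousAt.mul (by fun_prop) (ContinuousAt.div (by fun_prop) (by fun_prop) ?_)
        simpa using hs'
      have := hc.tendsto.mono_left (nhdsWithin_le_nhds (s := Ioi 0))
      simpa using this

lemma measureReal_Icc_le_of_integral_le {ρ : Measure ℝ} [IsFiniteMeasure ρ] {x y C : ℝ}
    (hy : 0 < y) (h : ∫ s : ℝ, (1 + s ^ 2) / ((s - x) ^ 2 + y ^ 2) ∂ρ ≤ C) :
    ρ.real (Icc (x - y) (x + y)) ≤ 2 * C * y ^ 2 := by
  have h1 : ∫ s : ℝ, (Icc (x - y) (x + y)).indicator (fun _ => (2 * y ^ 2)⁻¹) s ∂ρ ≤ C := by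
    refine le_trans (integral_mono ((integrable_const _).indicator measurableSet_Icc)
      (integrable_poisson_weight ρ x hy) fun s => ?_) h
    by_cases hs : s ∈ Icc (x - y) (x + y)
    · rw [indicator_of_mem hs, inv_eq_one_div]
      have : (s - x) ^ 2 ≤ y ^ 2 := sq_le_sq' (by linarith [hs.1]) (by linarith [hs.2])
      apply div_le_div₀ (by positivity) (by nlinarith) (by positivity) (by linarith)
    · rw [indicator_of_notMem hs]
      positivity
  rw [integral_indicator_const _ measurableSet_Icc, smul_eq_mul, ← div_eq_mul_inv,
    div_le_iff₀ (by positivity)] at h1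
  linarith

/-- A finite measure of quadratic decay around every point of an open interval vanishes on it. -/
lemma measure_Ioo_eq_zero {ρ : Measure ℝ} [IsFiniteMeasure ρ] {a b : ℝ}
    (h : ∀ x ∈ Ioo a b, ∃ C : ℝ, ∀ᶠ y in 𝓝[>] (0 : ℝ),
      ρ.real (Icc (x - y) (x + y)) ≤ C * y ^ 2) :
    ρ (Ioo a b) = 0 := by
  set f : ℝ → ℝ := fun x => ρ.real (Iic x) with hf
  have hdiff : ∀ u v : ℝ, u ≤ v → ρ.real (Ioc u v) = f v - f u := by
    intro u v huv
    rw [← Iic_sdiff_Iic, measureReal_sdiff (Iic_subset_Iic.mpr huv) measurableSet_Iic]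
  have hle : ∀ x t : ℝ, |f t - f x| ≤ ρ.real (Icc (x - |t - x|) (x + |t - x|)) := by
    intro x t
    rcases le_total x t with hxt | hxt
    · rw [← hdiff x t hxt, abs_of_nonneg measureReal_nonneg, abs_of_nonneg (sub_nonneg.mpr hxt)]
      exact measureReal_mono fun s hs => ⟨by linarith [hs.1], by linarith [hs.2]⟩
    · rw [abs_sub_comm, ← hdiff t x hxt, abs_of_nonneg measureReal_nonneg,
        abs_of_nonpos (sub_nonpos.mpr hxt)]
      exact measureReal_mono fun s hs => ⟨by linarith [hs.1], by linarith [hs.2]⟩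
  have hderiv : ∀ x ∈ Ioo a b, HasDerivAt f 0 x := by
    intro x hx
    obtain ⟨C, hC⟩ := h x hx
    have hev : ∀ᶠ t in 𝓝 x, |f t - f x| ≤ C * |t - x| ^ 2 := by
      have hT : Tendsto (fun t : ℝ => |t - x|) (𝓝[≠] x) (𝓝[>] 0) := by
        refine tendsto_nhdsWithin_iff.mpr ⟨?_, ?_⟩
        · have : ContinuousAt (fun t : ℝ => |t - x|) x := by fun_prop
          have := this.tendsto.mono_left (nhdsWithin_le_nhds (s := {x}ᶜ))
          simpa using this
        · filter_upwards [self_mem_nhdsWithin] with t ht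
          exact abs_pos.mpr (sub_ne_zero.mpr ht)
      have h1 := hT.eventually hC
      rw [eventually_nhdsWithin_iff] at h1
      filter_upwards [h1] with t ht
      by_cases htx : t = x
      · simp [htx]
      · exact (hle x t).trans (ht htx)
    rw [hasDerivAt_iff_isLittleO]
    have hO : (fun t => f t - f x) =O[𝓝 x] fun t => (t - x) ^ 2 := by
      refine Asymptotics.IsBigO.of_bound C ?_
      filter_upwards [hev] with t ht
      simpa using ht
    simpa using hO.trans_isLittleO
      (by simpa using Asymptotics.isLittleO_pow_sub_sub x one_lt_two)
  have hconst : ∀ u ∈ Ioo a b, ∀ v ∈ Ioo a b, f u = f v := by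
    intro u hu v hv
    refine (convex_Ioo a b).is_const_of_fderivWithin_eq_zero (𝕜 := ℝ) (f := f)
      (fun x hx => (hderiv x hx).differentiableAt.differentiableWithinAt) (fun x hx => ?_) hu hv
    rw [fderivWithin_of_isOpen isOpen_Ioo hx, (hderiv x hx).hasFDerivAt.fderiv]
    ext; simp
  refine measure_null_of_locally_null _ fun x hx => ?_
  obtain ⟨u, hu, hux⟩ := exists_between hx.1
  obtain ⟨v, hxv, hv⟩ := exists_between hx.2
  refine ⟨Ioc u v, mem_nhdsWithin_of_mem_nhds (Ioc_mem_nhds hux hxv), ?_⟩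
  rw [← measureReal_eq_zero_iff, hdiff u v (hux.trans hxv).le,
    hconst u ⟨hu, hux.trans hx.2⟩ v ⟨hx.1.trans hxv, hv⟩, sub_self]

end CauchyNevanlinna

open CauchyNevanlinna in
theorem stmt_14 (μ : Measure ℝ) [IsProbabilityMeasure μ]
    (ρ : Measure ℝ) [IsFiniteMeasure ρ] (a : ℝ)
    (hNev : ∀ z : ℂ, 0 < z.im →
      (∫ s : ℝ, (z - (s : ℂ))⁻¹ ∂μ)⁻¹
        = (a : ℂ) + z + ∫ s : ℝ, (1 + (s : ℂ) * z) / ((s : ℂ) - z) ∂ρ)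
    (c d x₀ : ℝ) (hx₀ : x₀ ∈ Ioo c d) (hμI : μ (Ioo c d) = 0)
    (hzero : (∫ s : ℝ, (x₀ - s)⁻¹ ∂μ) = 0) :
    ρ {x₀} = ENNReal.ofReal
        (-1 / ((x₀ ^ 2 + 1) * (-(∫ s : ℝ, ((x₀ - s) ^ 2)⁻¹ ∂μ)))) ∧
      ρ (Ioo c d \ {x₀}) = 0 := by
  have key : ∀ (x y : ℝ), 0 < y →
      (1 + ∫ s : ℝ, (1 + s ^ 2) / ((s - x) ^ 2 + y ^ 2) ∂ρ) * (((x - x₀) ^ 2 + y ^ 2) *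
        normSq (∫ s : ℝ, (((x + y * I : ℂ) - s) * (x₀ - s))⁻¹ ∂μ))
      = ∫ s : ℝ, ((x - s) ^ 2 + y ^ 2)⁻¹ ∂μ := by
    intro x y hy
    rw [← one_add_mul_normSq hNev x hy, cauchyTransform_eq_mul_dividedDifference hx₀ hμI hzero
      (z := x + y * I) (by simpa using hy), normSq_mul, normSq_neg]
    have : normSq ((x + y * I : ℂ) - x₀) = (x - x₀) ^ 2 + y ^ 2 := by
      simp [normSq_apply]; ring
    rw [this]
  have hH : ∀ x ∈ Ioo c d, Tendsto
      (fun y : ℝ => normSq (∫ s : ℝ, (((x + y * I : ℂ) - s) * (x₀ - s))⁻¹ ∂μ)) (𝓝[>] 0)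
      (𝓝 ((∫ s : ℝ, ((x - s) * (x₀ - s))⁻¹ ∂μ) ^ 2)) := by
    intro x hx
    have := (continuous_normSq.tendsto _).comp (tendsto_dividedDifference hx hx₀ hμI)
    rwa [normSq_ofReal, ← sq] at this
  constructor
  · set h := ∫ s : ℝ, ((x₀ - s) ^ 2)⁻¹ ∂μ with hh
    have hpos : 0 < h := by
      simpa only [hh, sq] using integral_inv_mul_pos hx₀ hx₀ hμI
    have hH₀ := hH x₀ hx₀
    simp only [← sq] at hH₀
    rw [← hh] at hH₀
    have hy2 : Tendsto (fun y : ℝ => y ^ 2) (𝓝[>] 0) (𝓝 0) := by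
      have : ContinuousAt (fun y : ℝ => y ^ 2) 0 := by fun_prop
      simpa using this.tendsto.mono_left (nhdsWithin_le_nhds (s := Ioi 0))
    have hL := (hy2.add (tendsto_sq_mul_integral ρ x₀)).mul hH₀
    have heq := tendsto_nhds_unique (hL.congr' ?_) (tendsto_integral_inv_sq_add hx₀ hμI)
    · rw [← hh] at heq
      rw [← ofReal_measureReal]
      congr 1
      have h1 : (1 + x₀ ^ 2) * ρ.real {x₀} * h = 1 := by
        refine mul_right_cancel₀ hpos.ne' ?_
        linarith
      rw [mul_neg, neg_div_neg_eq, eq_div_iff (by positivity)]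
      linarith
    · filter_upwards [self_mem_nhdsWithin] with y hy
      rw [← key x₀ y hy]
      ring
  · have hdecay : ∀ x ∈ Ioo c d, x ≠ x₀ → ∃ C : ℝ, ∀ᶠ y in 𝓝[>] (0 : ℝ),
        ρ.real (Icc (x - y) (x + y)) ≤ C * y ^ 2 := by
      intro x hx hne
      set h := ∫ s : ℝ, ((x - s) * (x₀ - s))⁻¹ ∂μ with hh
      have hpos : 0 < h ^ 2 := pow_pos (integral_inv_mul_pos hx hx₀ hμI) 2
      set n := ∫ s : ℝ, ((x - s) ^ 2)⁻¹ ∂μ with hn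
      have hsub : 0 < (x - x₀) ^ 2 := by
        have := sub_ne_zero.mpr hne
        positivity
      refine ⟨2 * ((n + 1) / ((x - x₀) ^ 2 * (h ^ 2 / 2))), ?_⟩
      filter_upwards [self_mem_nhdsWithin,
        (hH x hx).eventually_const_lt (half_lt_self hpos),
        (tendsto_integral_inv_sq_add hx hμI).eventually_lt_const (lt_add_one n)] with y hy h1 h2
      refine measureReal_Icc_le_of_integral_le hy ?_
      rw [le_div_iff₀ (by positivity)]
      have hR : 0 ≤ ∫ s : ℝ, (1 + s ^ 2) / ((s - x) ^ 2 + y ^ 2) ∂ρ :=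
        integral_nonneg fun s => by positivity
      rw [← key x y hy] at h2
      refine le_trans ?_ h2.le
      gcongr
      · linarith
      · nlinarith [sq_nonneg y]
    have hsub : Ioo c d \ {x₀} ⊆ Ioo c x₀ ∪ Ioo x₀ d := by
      rintro s ⟨hs, hs'⟩
      rcases lt_or_gt_of_ne hs' with h | h
      · exact Or.inl ⟨hs.1, h⟩
      · exact Or.inr ⟨h, hs.2⟩
    refine measure_mono_null hsub (measure_union_null ?_ ?_)
    · exact measure_Ioo_eq_zero fun x hx => hdecay x ⟨hx.1, hx.2.trans hx₀.2⟩ hx.2.ne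
    · exact measure_Ioo_eq_zero fun x hx => hdecay x ⟨hx₀.1.trans hx.1, hx.2⟩ hx.1.ne'
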